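/- Let k be a field of characteristic ≠ 2 and n ≥ 3. The number of nonzero solutions (a₁,...,aₙ) ∈ 𝔽_q^n of a₁² + ... + aₙ² = 0, divided by q−1 (i.e., the number of 𝔽_q-points of the projective quadric ∑aᵢ²=0), equals (q^{n−1} − χ q^{n/2−1} + χ q^{n/2} − 1)/(q−1), where χ = 0 if n is odd, χ = 1 if n is even and the quadratic form ∑xᵢ² on 𝔽_q^n is hyperbolic, and χ = −1 if n is even and the form is not hyperbolic. -/

import Mathlib

open scoped Classical

/-- The quadratic form `∑ xᵢ²` on `F^n` (for `n` even) is *hyperbolic* if it is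
an orthogonal sum of `n/2` hyperbolic planes, i.e. isometric to the form
`∑_{j} x_j y_j` on `F^{n/2} × F^{n/2}`. -/
def SumSqIsHyperbolic (F : Type*) [Field F] (n : ℕ) : Prop :=
  ∃ e : (Fin n → F) ≃ₗ[F] (Fin (n / 2) → F) × (Fin (n / 2) → F),
    ∀ v : Fin n → F, ∑ i, v i ^ 2 = ∑ j, (e v).1 j * (e v).2 j

section ZeroCount

variable {V W : Type*}

/-- The number of zeros of a function. -/
noncomputable def zeroCount {F : Type*} [Zero F] (Q : V → F) : ℕ :=
  Nat.card {v // Q v = 0}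

lemma zeroCount_congr {F : Type*} [Zero F] {Q : V → F} {R : W → F} (e : V ≃ W)
    (h : ∀ v, Q v = R (e v)) : zeroCount Q = zeroCount R :=
  Nat.card_congr (e.subtypeEquiv fun v => by rw [h])

lemma zeroCount_eq_sum {F : Type*} [Zero F] [Fintype V] (Q : V → F) :
    zeroCount Q = ∑ v, if Q v = 0 then 1 else 0 := by
  simp [zeroCount, Nat.card_eq_fintype_card, Fintype.card_subtype]

variable {F : Type*} [Field F]

/-- Adding a hyperbolic plane to a function `Q`. -/
lemma zeroCount_mul_add [Fintype F] [Fintype V] (Q : V → F) :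
    zeroCount (fun p : F × F × V => p.1 * p.2.1 + Q p.2.2) + Fintype.card V =
      Fintype.card F * Fintype.card V + Fintype.card F * zeroCount Q := by
  have hx : ∀ x : F, x ≠ 0 →
      (∑ y : F, ∑ v : V, if x * y + Q v = 0 then 1 else 0) = Fintype.card V := by
    intro x hx
    rw [Finset.sum_comm]
    have : ∀ v : V, (∑ y : F, if x * y + Q v = 0 then 1 else 0) = 1 := by
      intro v
      have hy : ∀ y : F, x * y + Q v = 0 ↔ y = -Q v / x := by
        intro y
        rw [eq_div_iff hx, eq_neg_iff_add_eq_zero, mul_comm x y]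
      simp [hy]
    simp [this]
  have hcard : 0 < Fintype.card F := Fintype.card_pos
  rw [zeroCount_eq_sum, zeroCount_eq_sum, Fintype.sum_prod_type]
  simp only [Fintype.sum_prod_type]
  rw [← Finset.add_sum_erase _ _ (Finset.mem_univ (0 : F)),
    Finset.sum_congr rfl fun x h => hx x (Finset.ne_of_mem_erase h)]
  simp only [zero_mul, zero_add, Finset.sum_const, Finset.card_univ, smul_eq_mul,
    Finset.card_erase_of_mem (Finset.mem_univ _)]
  obtain ⟨c, hc⟩ := Nat.exists_eq_add_of_lt hcard
  simp only [hc]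
  simp only [zero_add, Nat.add_sub_cancel]
  ring

lemma exists_sq_add_sq_eq_neg_one [Fintype F] (hchar : ringChar F ≠ 2) : ∃ a b : F, a ^ 2 + b ^ 2 = -1 := by
  obtain ⟨a, b, h⟩ := FiniteField.exists_root_sum_quadratic
    (f := (Polynomial.X ^ 2 : Polynomial F)) (g := Polynomial.X ^ 2 - Polynomial.C (-1))
    (Polynomial.degree_X_pow 2) (Polynomial.degree_X_pow_sub_C (by decide) _)
    (FiniteField.odd_card_of_char_ne_two hchar)
  refine ⟨a, b, ?_⟩
  rw [← sub_eq_zero]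
  simpa only [Polynomial.eval_C, Polynomial.eval_X, Polynomial.eval_pow, Polynomial.eval_sub,
    ← add_sub_assoc] using h

/-- Three squares split off a hyperbolic plane. -/
lemma zeroCount_three_sq_add [Fintype F] (hchar : ringChar F ≠ 2) (Q : V → F) :
    zeroCount (fun p : F × F × F × V => p.1 ^ 2 + (p.2.1 ^ 2 + (p.2.2.1 ^ 2 + Q p.2.2.2))) =
      zeroCount (fun p : F × F × F × V => p.1 * p.2.1 + (-p.2.2.1 ^ 2 + Q p.2.2.2)) := by
  have h2 : (2 : F) ≠ 0 := Ring.two_ne_zero hchar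
  obtain ⟨a, b, hab⟩ := exists_sq_add_sq_eq_neg_one hchar
  refine zeroCount_congr
    { toFun := fun p => (p.2.2.1 - (a * p.1 + b * p.2.1), p.2.2.1 + (a * p.1 + b * p.2.1),
        b * p.1 - a * p.2.1, p.2.2.2)
      invFun := fun p => (-(a * ((p.2.1 - p.1) / 2) + b * p.2.2.1),
        -(b * ((p.2.1 - p.1) / 2) - a * p.2.2.1), (p.1 + p.2.1) / 2, p.2.2.2)
      left_inv := ?_
      right_inv := ?_ } ?_
  · rintro ⟨x, y, z, v⟩
    simp only [Prod.mk.injEq, and_true]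
    refine ⟨?_, ?_, ?_⟩
    · field_simp
      linear_combination -2 * x * hab
    · field_simp
      linear_combination -2 * y * hab
    · field_simp
      ring
  · rintro ⟨x, y, z, v⟩
    simp only [Prod.mk.injEq, and_true]
    refine ⟨?_, ?_, ?_⟩
    · field_simp
      linear_combination (y - x) * hab
    · field_simp
      linear_combination (x - y) * hab
    · field_simp
      linear_combination -2 * z * hab
  · rintro ⟨x, y, z, v⟩
    simp only [Equiv.coe_fn_mk]
    linear_combination (x ^ 2 + y ^ 2) * hab

lemma zeroCount_neg_sq_add_sq_add (hchar : ringChar F ≠ 2) (Q : V → F) :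
    zeroCount (fun p : F × F × V => -p.1 ^ 2 + (p.2.1 ^ 2 + Q p.2.2)) =
      zeroCount (fun p : F × F × V => p.1 * p.2.1 + Q p.2.2) := by
  have h2 : (2 : F) ≠ 0 := Ring.two_ne_zero hchar
  refine zeroCount_congr
    { toFun := fun p => (p.2.1 - p.1, p.2.1 + p.1, p.2.2)
      invFun := fun p => ((p.2.1 - p.1) / 2, (p.1 + p.2.1) / 2, p.2.2)
      left_inv := ?_
      right_inv := ?_ } ?_
  · rintro ⟨x, y, v⟩
    simp only [Prod.mk.injEq, and_true]
    constructor <;> field_simp <;> ring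
  · rintro ⟨x, y, v⟩
    simp only [Prod.mk.injEq, and_true]
    constructor <;> field_simp <;> ring
  · rintro ⟨x, y, v⟩
    simp only [Equiv.coe_fn_mk]
    ring

/-- The number of zeros of a sum of `n` squares. -/
noncomputable def sumSqCount (F : Type*) [Field F] (n : ℕ) : ℕ :=
  zeroCount fun v : Fin n → F => ∑ i, v i ^ 2

lemma sumSqCount_add_three [Fintype F] (hchar : ringChar F ≠ 2) (n : ℕ) :
    sumSqCount F (n + 3) + Fintype.card F ^ (n + 1) = Fintype.card F ^ (n + 2) +
      Fintype.card F *
        zeroCount (fun p : F × (Fin n → F) => -p.1 ^ 2 + ∑ i, p.2 i ^ 2) := by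
  have h := zeroCount_mul_add (fun p : F × (Fin n → F) => -p.1 ^ 2 + ∑ i, p.2 i ^ 2)
  rw [← zeroCount_three_sq_add hchar (fun v : Fin n → F => ∑ i, v i ^ 2)] at h
  have e : sumSqCount F (n + 3) = zeroCount (fun p : F × F × F × (Fin n → F) =>
      p.1 ^ 2 + (p.2.1 ^ 2 + (p.2.2.1 ^ 2 + ∑ i, p.2.2.2 i ^ 2))) := by
    symm
    refine zeroCount_congr
      (((Equiv.refl F).prodCongr (((Equiv.refl F).prodCongr
        (Fin.consEquiv fun _ => F)).trans (Fin.consEquiv fun _ => F))).trans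
        (Fin.consEquiv fun _ => F)) ?_
    rintro ⟨x, y, z, v⟩
    simp [Fin.consEquiv, Fin.sum_univ_succ]
  simp only [Fintype.card_prod, Fintype.card_pi, Finset.prod_const, Finset.card_univ,
    Fintype.card_fin] at h
  rw [e, pow_succ', h]
  ring

lemma sumSqCount_add_four [Fintype F] (hchar : ringChar F ≠ 2) (n : ℕ) :
    sumSqCount F (n + 4) + Fintype.card F ^ (n + 1) =
      Fintype.card F ^ (n + 3) + Fintype.card F ^ 2 * sumSqCount F n := by
  have h := zeroCount_mul_add (fun v : Fin n → F => ∑ i, v i ^ 2)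
  rw [← zeroCount_neg_sq_add_sq_add hchar (fun v : Fin n → F => ∑ i, v i ^ 2)] at h
  have e : zeroCount (fun p : F × F × (Fin n → F) =>
      -p.1 ^ 2 + (p.2.1 ^ 2 + ∑ i, p.2.2 i ^ 2)) =
      zeroCount (fun p : F × (Fin (n + 1) → F) => -p.1 ^ 2 + ∑ i, p.2 i ^ 2) := by
    refine zeroCount_congr ((Equiv.refl F).prodCongr (Fin.consEquiv fun _ => F)) ?_
    rintro ⟨x, y, v⟩
    simp [Fin.consEquiv, Fin.sum_univ_succ]
  have h3 := sumSqCount_add_three hchar (n + 1)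
  simp only [Fintype.card_pi, Finset.prod_const, Finset.card_univ, Fintype.card_fin] at h
  rw [e] at h
  change _ = _ + _ * sumSqCount F n at h
  change sumSqCount F (n + 4) + _ = _ at h3
  zify at h h3 ⊢
  linear_combination h3 + (Fintype.card F : ℤ) * h

lemma sumSqCount_one : sumSqCount F 1 = 1 := by
  rw [sumSqCount, zeroCount, Nat.card_eq_one_iff_unique]
  refine ⟨⟨?_⟩, ⟨⟨0, by simp⟩⟩⟩
  rintro ⟨v, hv⟩ ⟨w, hw⟩
  have hv0 : v 0 = 0 := by simpa using hv
  have hw0 : w 0 = 0 := by simpa using hw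
  ext i
  fin_cases i
  exact hv0.trans hw0.symm

lemma sumSqCount_two (h : ¬ IsSquare (-1 : F)) : sumSqCount F 2 = 1 := by
  rw [sumSqCount, zeroCount, Nat.card_eq_one_iff_unique]
  have key : ∀ v : Fin 2 → F, ∑ i, v i ^ 2 = 0 → v = 0 := by
    intro v hv
    rw [Fin.sum_univ_two] at hv
    have h1 : v 1 = 0 := by
      by_contra h1
      refine h ⟨v 0 / v 1, ?_⟩
      field_simp
      linear_combination -hv
    have h0 : v 0 = 0 := by simpa [h1] using hv
    ext i
    fin_cases i <;> assumption
  refine ⟨⟨?_⟩, ⟨⟨0, by simp⟩⟩⟩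
  rintro ⟨v, hv⟩ ⟨w, hw⟩
  exact Subtype.ext ((key v hv).trans (key w hw).symm)

lemma sumSqCount_three [Fintype F] (hchar : ringChar F ≠ 2) : sumSqCount F 3 = Fintype.card F ^ 2 := by
  have h := sumSqCount_add_three hchar 0
  have e : zeroCount (fun p : F × (Fin 0 → F) => -p.1 ^ 2 + ∑ i, p.2 i ^ 2) = 1 := by
    rw [zeroCount, Nat.card_eq_one_iff_unique]
    refine ⟨⟨?_⟩, ⟨⟨0, by simp⟩⟩⟩
    rintro ⟨⟨x, v⟩, hx⟩ ⟨⟨y, w⟩, hy⟩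
    have hx0 : x = 0 := by simpa using hx
    have hy0 : y = 0 := by simpa using hy
    simp [hx0, hy0, Subsingleton.elim v w]
  rw [e] at h
  simp only [zero_add, pow_one, mul_one] at h
  exact Nat.add_right_cancel h

lemma sumSqCount_odd [Fintype F] (hchar : ringChar F ≠ 2) (k : ℕ) :
    sumSqCount F (2 * k + 1) = Fintype.card F ^ (2 * k) := by
  induction k using Nat.twoStepInduction with
  | zero => simpa using sumSqCount_one (F := F)
  | one => exact sumSqCount_three hchar
  | more k ih _ =>
    have h := sumSqCount_add_four hchar (2 * k + 1)
    rw [ih] at h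
    rw [show 2 * (k + 2) + 1 = 2 * k + 1 + 4 by ring]
    zify at h ⊢
    linear_combination h

lemma sumSqCount_four_mul_add_two [Fintype F] (hchar : ringChar F ≠ 2) (hsq : ¬ IsSquare (-1 : F)) (k : ℕ) :
    (Fintype.card F : ℤ) * sumSqCount F (4 * k + 2) =
      Fintype.card F ^ (4 * k + 2) - (Fintype.card F - 1) * Fintype.card F ^ (2 * k + 1) := by
  induction k with
  | zero =>
    simp [sumSqCount_two hsq]
    ring
  | succ k ih =>
    have h := sumSqCount_add_four hchar (4 * k + 2)
    rw [show 4 * (k + 1) + 2 = 4 * k + 2 + 4 by ring]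
    zify at h
    linear_combination (Fintype.card F : ℤ) * h + (Fintype.card F : ℤ) ^ 2 * ih

lemma zeroCount_sum_mul [Fintype F] (m : ℕ) :
    (Fintype.card F : ℤ) *
        zeroCount (fun p : (Fin m → F) × (Fin m → F) => ∑ j, p.1 j * p.2 j) =
      Fintype.card F ^ (2 * m) + (Fintype.card F - 1) * Fintype.card F ^ m := by
  induction m with
  | zero => simp [zeroCount]
  | succ m ih =>
    have h := zeroCount_mul_add
      (fun p : (Fin m → F) × (Fin m → F) => ∑ j, p.1 j * p.2 j)
    have e : zeroCount (fun p : F × F × ((Fin m → F) × (Fin m → F)) =>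
        p.1 * p.2.1 + ∑ j, p.2.2.1 j * p.2.2.2 j) =
        zeroCount (fun p : (Fin (m + 1) → F) × (Fin (m + 1) → F) => ∑ j, p.1 j * p.2 j) := by
      refine zeroCount_congr
        { toFun := fun p => (Fin.cons p.1 p.2.2.1, Fin.cons p.2.1 p.2.2.2)
          invFun := fun p => (p.1 0, p.2 0, Fin.tail p.1, Fin.tail p.2)
          left_inv := fun p => by simp
          right_inv := fun p => by simp } ?_
      rintro ⟨x, y, v, w⟩
      simp [Fin.sum_univ_succ]
    rw [e] at h
    simp only [Fintype.card_prod, Fintype.card_pi, Finset.prod_const, Finset.card_univ,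
      Fintype.card_fin] at h
    zify at h
    linear_combination (Fintype.card F : ℤ) * h + (Fintype.card F : ℤ) * ih

end ZeroCount

section Hyperbolic

variable {F : Type*} [Field F]

/-- The sum of `n` squares is a sum of `m` products of linear forms. -/
def SumSqIsSumMul (F : Type*) [Field F] (n m : ℕ) : Prop :=
  ∃ f g : Fin m → Module.Dual F (Fin n → F), ∀ v, ∑ i, v i ^ 2 = ∑ j, f j v * g j v

lemma sumSqIsSumMul_zero : SumSqIsSumMul F 0 0 :=
  ⟨0, 0, by simp⟩

lemma SumSqIsSumMul.add_two {n m : ℕ} (hsq : IsSquare (-1 : F)) (h : SumSqIsSumMul F n m) :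
    SumSqIsSumMul F (n + 2) (m + 1) := by
  obtain ⟨i, hi⟩ := hsq
  obtain ⟨f, g, h⟩ := h
  let x (k : Fin (n + 2)) : Module.Dual F (Fin (n + 2) → F) := LinearMap.proj k
  let r : (Fin (n + 2) → F) →ₗ[F] (Fin n → F) := LinearMap.funLeft F F fun k => k.succ.succ
  refine ⟨Fin.cons (x 0 + i • x 1) fun j => f j ∘ₗ r,
    Fin.cons (x 0 - i • x 1) fun j => g j ∘ₗ r, fun v => ?_⟩
  have hv := h (r v)
  simp only [r, LinearMap.funLeft_apply] at hv
  simp only [Fin.sum_univ_succ, Fin.cons_zero, Fin.cons_succ, LinearMap.comp_apply, r, x, ← hv,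
    LinearMap.add_apply, LinearMap.sub_apply, LinearMap.smul_apply, LinearMap.proj_apply,
    smul_eq_mul, Fin.succ_zero_eq_one]
  linear_combination -v 1 ^ 2 * hi

lemma SumSqIsSumMul.add_four {n m : ℕ} {a b : F} (hab : a ^ 2 + b ^ 2 = -1)
    (h : SumSqIsSumMul F n m) : SumSqIsSumMul F (n + 4) (m + 2) := by
  obtain ⟨f, g, h⟩ := h
  let x (k : Fin (n + 4)) : Module.Dual F (Fin (n + 4) → F) := LinearMap.proj k
  let y := a • x 0 + b • x 1
  let z := b • x 0 - a • x 1
  let r : (Fin (n + 4) → F) →ₗ[F] (Fin n → F) :=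
    LinearMap.funLeft F F fun k => k.succ.succ.succ.succ
  refine ⟨Fin.cons (x 2 - y) (Fin.cons (x 3 - z) fun j => f j ∘ₗ r),
    Fin.cons (x 2 + y) (Fin.cons (x 3 + z) fun j => g j ∘ₗ r), fun v => ?_⟩
  have hv := h (r v)
  simp only [r, LinearMap.funLeft_apply] at hv
  simp only [Fin.sum_univ_succ, Fin.cons_zero, Fin.cons_succ, LinearMap.comp_apply, r, x, y, z,
    ← hv, LinearMap.add_apply, LinearMap.sub_apply, LinearMap.smul_apply, LinearMap.proj_apply,
    smul_eq_mul, Fin.succ_zero_eq_one]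
  have e2 : (Fin.succ 1 : Fin (n + 3)).succ = 3 := rfl
  have e1 : (Fin.succ 1 : Fin (n + 4)) = 2 := rfl
  simp only [e1, e2]
  linear_combination (v 0 ^ 2 + v 1 ^ 2) * hab

lemma SumSqIsSumMul.sumSqIsHyperbolic {m : ℕ} (h2 : (2 : F) ≠ 0)
    (h : SumSqIsSumMul F (2 * m) m) : SumSqIsHyperbolic F (2 * m) := by
  obtain ⟨f, g, h⟩ := h
  let T : (Fin (2 * m) → F) →ₗ[F] (Fin m → F) × (Fin m → F) :=
    (LinearMap.pi f).prod (LinearMap.pi g)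
  have hT : Function.Injective T := by
    rw [injective_iff_map_eq_zero]
    intro v hv
    have hf : ∀ j, f j v = 0 := fun j => congrFun (congrArg Prod.fst hv) j
    have hg : ∀ j, g j v = 0 := fun j => congrFun (congrArg Prod.snd hv) j
    ext i
    have h0 : ∑ k, v k ^ 2 = 0 := by simp [h, hf]
    have h1 := h (v + Pi.single i 1)
    simp only [map_add, hf, hg, zero_add, ← h] at h1
    simp only [Pi.add_apply, add_sq, Finset.sum_add_distrib, h0, zero_add, add_eq_right] at h1
    simpa [Pi.single_apply, h2] using h1
  rw [SumSqIsHyperbolic, Nat.mul_div_cancel_left m two_pos]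
  refine ⟨LinearEquiv.ofInjectiveOfFinrankEq T hT (by simp [two_mul]), fun v => ?_⟩
  rw [h]
  rfl

end Hyperbolic

/-- A sum of an even number of squares is hyperbolic, except possibly when `-1` is not a square
and the number of squares is `2` modulo `4`. -/
lemma sumSqIsHyperbolic_of_even {F : Type*} [Field F] [Fintype F] (hchar : ringChar F ≠ 2)
    {m : ℕ} (hm : IsSquare (-1 : F) ∨ Even m) : SumSqIsHyperbolic F (2 * m) := by
  refine SumSqIsSumMul.sumSqIsHyperbolic (Ring.two_ne_zero hchar) ?_
  rcases hm with hsq | ⟨k, rfl⟩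
  · induction m with
    | zero => exact sumSqIsSumMul_zero
    | succ m ih => exact ih.add_two hsq
  · obtain ⟨a, b, hab⟩ := exists_sq_add_sq_eq_neg_one hchar
    induction k with
    | zero => exact sumSqIsSumMul_zero
    | succ k ih =>
      have := ih.add_four hab
      convert this using 1 <;> ring

/-- The nonzero zeros of a function, homogeneous of degree two, are fibred over the projective
zeros with fibre the units. -/
lemma card_projective_zeros_mul {F V : Type*} [Field F] [Fintype F] [AddCommGroup V] [Module F V]
    [Finite V] (Q : V → F) (hQ : ∀ (c : F) v, Q (c • v) = c ^ 2 * Q v) :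
    (Nat.card {l : Projectivization F V // Q l.rep = 0} : ℤ) * (Fintype.card F - 1) =
      zeroCount Q - 1 := by
  have hQ0 : Q 0 = 0 := by simpa using hQ 0 0
  let T : {l : Projectivization F V // Q l.rep = 0} × Fˣ → {v : {v // Q v = 0} // v ≠ ⟨0, hQ0⟩} :=
    fun p => ⟨⟨(p.2 : F) • p.1.1.rep, by rw [hQ, p.1.2, mul_zero]⟩, fun h =>
      smul_ne_zero p.2.ne_zero p.1.1.rep_nonzero (congrArg Subtype.val h)⟩
  have hT : Function.Bijective T := by
    constructor
    · rintro ⟨⟨l, hl⟩, u⟩ ⟨⟨l', hl'⟩, u'⟩ h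
      have h' : (u : F) • l.rep = (u' : F) • l'.rep :=
        congrArg (fun v => v.1.1) h
      have hll : l = l' := by
        rw [← l.mk_rep, ← l'.mk_rep, Projectivization.mk_eq_mk_iff]
        refine ⟨u⁻¹ * u', ?_⟩
        rw [mul_smul, Units.smul_def u', ← h', ← Units.smul_def, inv_smul_smul]
      subst hll
      have hu : u = u' := Units.ext (smul_left_injective F l.rep_nonzero h')
      rw [hu]
    · rintro ⟨⟨v, hv⟩, hv0⟩
      have hv0' : v ≠ 0 := fun h => hv0 (Subtype.ext h)
      obtain ⟨c, hc⟩ := Projectivization.exists_smul_eq_mk_rep F v hv0'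
      refine ⟨⟨⟨Projectivization.mk F v hv0', ?_⟩, c⁻¹⟩, ?_⟩
      · rw [← hc, Units.smul_def, hQ, hv, mul_zero]
      · refine Subtype.ext (Subtype.ext ?_)
        change ((c⁻¹ : Fˣ) : F) • (Projectivization.mk F v hv0').rep = v
        rw [← hc, ← Units.smul_def, inv_smul_smul]
  have : Fintype V := Fintype.ofFinite V
  have hcard := Nat.card_congr (Equiv.ofBijective T hT)
  rw [Nat.card_prod, Nat.card_eq_fintype_card (α := Fˣ), Fintype.card_units,
    Nat.card_eq_fintype_card (α := {v : {v // Q v = 0} // v ≠ ⟨0, hQ0⟩}),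
    Fintype.card_subtype_compl, Fintype.card_subtype_eq] at hcard
  have hpos : 1 ≤ Fintype.card {v // Q v = 0} := Fintype.card_pos_iff.2 ⟨⟨0, hQ0⟩⟩
  have hF : 1 ≤ Fintype.card F := Fintype.card_pos
  rw [zeroCount, Nat.card_eq_fintype_card (α := {v // Q v = 0}), ← Nat.cast_pred hpos, ← hcard]
  push_cast [hF]
  rfl

/-- Point count for the projective quadric `∑ aᵢ² = 0` in `ℙ^{n−1}(𝔽_q)`,
`q` odd, `n ≥ 3`: the number `z` of its `𝔽_q`-points (i.e. the number of
nonzero solutions divided by `q − 1`) satisfies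
`z (q−1) = q^{n−1} − χ q^{n/2−1} + χ q^{n/2} − 1`, where `χ = 0` if `n` is odd,
`χ = 1` if `n` is even and `∑ xᵢ²` is hyperbolic, and `χ = −1` otherwise. -/
theorem stmt_0 (F : Type*) [Field F] [Fintype F]
    (hchar : ringChar F ≠ 2) (n : ℕ) (hn : 3 ≤ n)
    (q : ℕ) (hq : q = Fintype.card F)
    (z : ℕ)
    (hz : z = Nat.card {l : Projectivization F (Fin n → F) // ∑ i, l.rep i ^ 2 = 0})
    (χ : ℤ)
    (hχ : χ = if Odd n then 0 else if SumSqIsHyperbolic F n then 1 else -1) :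
    (z : ℤ) * (q - 1) = q ^ (n - 1) - χ * q ^ (n / 2 - 1) + χ * q ^ (n / 2) - 1 := by
  have hz' := card_projective_zeros_mul (fun v : Fin n → F => ∑ i, v i ^ 2)
    (fun c v => by simp [mul_pow, Finset.mul_sum])
  change _ = ((sumSqCount F n : ℕ) : ℤ) - 1 at hz'
  rw [← hz, ← hq] at hz'
  rw [hz']
  have hq0 : (q : ℤ) ≠ 0 := by
    rw [hq]
    exact_mod_cast Fintype.card_ne_zero
  rcases Nat.even_or_odd' n with ⟨m, rfl | rfl⟩
  · have hm : 2 * m / 2 = m := Nat.mul_div_cancel_left m two_pos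
    have hodd : ¬ Odd (2 * m) := by simp
    have hcount : (q : ℤ) * sumSqCount F (2 * m) = q ^ (2 * m) + χ * (q - 1) * q ^ m := by
      rw [if_neg hodd] at hχ
      split_ifs at hχ with hyp
      · obtain ⟨e, he⟩ := hyp
        have hzero := zeroCount_sum_mul (F := F) (2 * m / 2)
        rw [← zeroCount_congr e.toEquiv he, hm, ← hq] at hzero
        rw [hχ, one_mul]
        exact hzero
      · have hns := mt (sumSqIsHyperbolic_of_even hchar) hyp
        rw [not_or, Nat.not_even_iff_odd] at hns
        obtain ⟨hsq, k, rfl⟩ := hns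
        have hzero := sumSqCount_four_mul_add_two hchar hsq k
        rw [← hq] at hzero
        rw [hχ, show 2 * (2 * k + 1) = 4 * k + 2 by ring, hzero]
        ring
    obtain ⟨l, rfl⟩ : ∃ l, m = l + 1 := ⟨m - 1, by omega⟩
    rw [hm, show 2 * (l + 1) - 1 = 2 * l + 1 by omega, Nat.add_sub_cancel]
    apply mul_left_cancel₀ hq0
    linear_combination hcount
  · rw [if_pos (odd_two_mul_add_one m)] at hχ
    rw [sumSqCount_odd hchar, hχ, hq, Nat.add_sub_cancel]
    push_cast
    ring
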